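/- arXiv:2006.03038 — 2 statements merged into one kernel-verified Lean document; each statement's English description precedes it below -/
import Mathlib

section
/- Let G and E be real Banach spaces, let k ≥ 1 be an integer, and let T : G → L(E,E) be a C^k map into the Banach space of bounded linear operators on E. Let γ₀ ∈ G, λ₀ ∈ ℝ and φ₀ ∈ E with φ₀ ≠ 0 and T(γ₀)φ₀ = −λ₀·φ₀. Let W ⊆ E be a closed subspace such that the continuous linear map Φ : ℝ × W → E defined by Φ(s,w) = T(γ₀)w + λ₀·w + s·φ₀ is bijective. Then there exist an open neighborhood V ⊆ G of γ₀ and C^k maps λ : V → ℝ and φ : V → E such that λ(γ₀) = λ₀, φ(γ₀) = φ₀, and T(γ)(φ(γ)) = −λ(γ)·φ(γ) for every γ ∈ V. -/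
/-- Implicit-function-theorem step for eigenvalue branches of a `C^k` family of
operators on a Banach space. -/
theorem stmt9 {G E : Type*}
    [NormedAddCommGroup G] [NormedSpace ℝ G] [CompleteSpace G]
    [NormedAddCommGroup E] [NormedSpace ℝ E] [CompleteSpace E]
    (k : ℕ) (hk : 1 ≤ k)
    (T : G → E →L[ℝ] E) (hT : ContDiff ℝ k T)
    (γ₀ : G) (lam₀ : ℝ) (φ₀ : E) (hφ₀ : φ₀ ≠ 0)
    (heig : T γ₀ φ₀ = -lam₀ • φ₀)
    (W : Submodule ℝ E) (hW : IsClosed (W : Set E))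
    (Φ : ℝ × W →L[ℝ] E)
    (hΦdef : ∀ (s : ℝ) (w : W), Φ (s, w) = T γ₀ (w : E) + lam₀ • (w : E) + s • φ₀)
    (hbij : Function.Bijective Φ) :
    ∃ V : Set G, IsOpen V ∧ γ₀ ∈ V ∧
      ∃ (lam : G → ℝ) (φ : G → E),
        ContDiffOn ℝ k lam V ∧ ContDiffOn ℝ k φ V ∧
        lam γ₀ = lam₀ ∧ φ γ₀ = φ₀ ∧
        ∀ γ ∈ V, T γ (φ γ) = -lam γ • φ γ := by
  have : CompleteSpace W := hW.completeSpace_coe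
  have hk0 : (k : WithTop ℕ∞) ≠ 0 := by
    simpa using Nat.one_le_iff_ne_zero.mp hk
  let f : G × ℝ × W → E := fun p =>
    T p.1 (φ₀ + W.subtypeL p.2.2) + (lam₀ + p.2.1) • (φ₀ + W.subtypeL p.2.2)
  have hf : ContDiff ℝ k f := by
    have hT' : ContDiff ℝ k fun p : G × ℝ × W => T p.1 := hT.comp contDiff_fst
    have hw : ContDiff ℝ k fun p : G × ℝ × W => φ₀ + W.subtypeL p.2.2 :=
      contDiff_const.add (W.subtypeL.contDiff.comp (contDiff_snd.comp contDiff_snd))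
    exact (hT'.clm_apply hw).add
      ((contDiff_const.add (contDiff_fst.comp contDiff_snd)).smul hw)
  have hf0 : f (γ₀, 0) = 0 := by simp [f, heig]
  have hfderiv : fderiv ℝ f (γ₀, 0) ∘L .inr ℝ G (ℝ × W) = Φ := by
    have hpair : HasFDerivAt (fun x : ℝ × W => (γ₀, x)) (.inr ℝ G (ℝ × W)) 0 :=
      hasFDerivAt_prodMk_right γ₀ 0
    have hcomp : HasFDerivAt (fun x : ℝ × W => f (γ₀, x))
        (fderiv ℝ f (γ₀, 0) ∘L .inr ℝ G (ℝ × W)) 0 :=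
      HasFDerivAt.comp (0 : ℝ × W)
        (hf.differentiable hk0 (γ₀, 0)).hasFDerivAt hpair
    have hw : HasFDerivAt (fun x : ℝ × W => φ₀ + W.subtypeL x.2)
        (W.subtypeL ∘L .snd ℝ ℝ W) 0 :=
      (W.subtypeL ∘L .snd ℝ ℝ W).hasFDerivAt.const_add φ₀
    have hs : HasFDerivAt (fun x : ℝ × W => lam₀ + x.1) (.fst ℝ ℝ W) 0 :=
      (ContinuousLinearMap.fst ℝ ℝ W).hasFDerivAt.const_add lam₀
    refine hcomp.unique ((((T γ₀).hasFDerivAt.comp (0 : ℝ × W) hw).add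
      (hs.smul hw)).congr_fderiv ?_)
    refine ContinuousLinearMap.ext fun ⟨s, w⟩ => ?_
    simp [hΦdef, add_assoc]
  have hinv : (fderiv ℝ f (γ₀, 0) ∘L .inr ℝ G (ℝ × W)).IsInvertible := by
    rw [hfderiv]
    exact ⟨ContinuousLinearEquiv.ofBijective Φ (LinearMap.ker_eq_bot.mpr hbij.1)
      (LinearMap.range_eq_top.mpr hbij.2), ContinuousLinearEquiv.coe_ofBijective ..⟩
  have hfat : ContDiffAt ℝ k f (γ₀, 0) := hf.contDiffAt
  set ψ := hfat.implicitFunction hk0 hinv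
  have hψ0 : ψ γ₀ = 0 := hfat.implicitFunction_apply_self hk0 hinv
  have hψsmooth : ∀ᶠ γ in nhds γ₀, ContDiffAt ℝ k ψ γ :=
    (hfat.contDiffAt_implicitFunction hk0 hinv).eventually (by simp)
  have hψeq : ∀ᶠ γ in nhds γ₀, f (γ, ψ γ) = 0 := by
    simpa only [hf0] using hfat.eventually_apply_implicitFunction hk0 hinv
  obtain ⟨V, hV, hVopen, hγ₀⟩ := eventually_nhds_iff.mp (hψsmooth.and hψeq)
  have hψV : ContDiffOn ℝ k ψ V := fun γ hγ => (hV γ hγ).1.contDiffWithinAt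
  refine ⟨V, hVopen, hγ₀, fun γ => lam₀ + (ψ γ).1, fun γ => φ₀ + W.subtypeL (ψ γ).2,
    contDiffOn_const.add (contDiff_fst.comp_contDiffOn hψV),
    contDiffOn_const.add (W.subtypeL.contDiff.comp_contDiffOn
      (contDiff_snd.comp_contDiffOn hψV)), by simp [hψ0], by simp [hψ0], fun γ hγ => ?_⟩
  rw [neg_smul]
  exact eq_neg_of_add_eq_zero_left (hV γ hγ).2
end

section
/- Let n ≥ 1 and k ≥ 1 be integers, let G be a real Banach space, let U ⊆ G be open, and let A : U → M_n(ℝ) be a C^k map such that A(γ) is a symmetric matrix for every γ ∈ U. Let γ₀ ∈ U, λ₀ ∈ ℝ and v₀ ∈ ℝⁿ with ‖v₀‖ = 1, A(γ₀)v₀ = λ₀·v₀, and suppose the eigenspace ker(A(γ₀) − λ₀·I) is one-dimensional. Then there exist an open neighborhood V ⊆ U of γ₀ and C^k maps λ : V → ℝ and v : V → ℝⁿ such that λ(γ₀) = λ₀, v(γ₀) = v₀, and A(γ)·v(γ) = λ(γ)·v(γ) for every γ ∈ V. -/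
attribute [local instance] Matrix.normedAddCommGroup Matrix.normedSpace

open scoped Topology

/-- The map whose level sets in `(s, w)` encode the eigenpair equation `M w = s w` together with a
linear normalization of `w` against `v₀`. -/
def eigenpairMap {n : ℕ} (v₀ : Fin n → ℝ) (M : Matrix (Fin n) (Fin n) ℝ)
    (p : ℝ × (Fin n → ℝ)) : ℝ × (Fin n → ℝ) :=
  (v₀ ⬝ᵥ p.2, M.mulVec p.2 - p.1 • p.2)

theorem contDiffAt_eigenpairMap {n : ℕ} {k : WithTop ℕ∞} {G : Type*} [NormedAddCommGroup G]
    [NormedSpace ℝ G] {A : G → Matrix (Fin n) (Fin n) ℝ} (v₀ : Fin n → ℝ)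
    {u : G × (ℝ × (Fin n → ℝ))} (hA : ContDiffAt ℝ k A u.1) :
    ContDiffAt ℝ k (fun x : G × (ℝ × (Fin n → ℝ)) => eigenpairMap v₀ (A x.1) x.2) u := by
  have hentry (i j : Fin n) :
      ContDiffAt ℝ k (fun x : G × (ℝ × (Fin n → ℝ)) => A x.1 i j) u :=
    (contDiffAt_pi.1 (contDiffAt_pi.1 hA i) j).comp u contDiffAt_fst
  have hvec (j : Fin n) : ContDiffAt ℝ k (fun x : G × (ℝ × (Fin n → ℝ)) => x.2.2 j) u := by
    fun_prop
  refine ContDiffAt.prodMk ?_ (contDiffAt_pi.2 fun i => ?_)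
  · exact ContDiffAt.sum fun j _ => contDiffAt_const.mul (hvec j)
  · have hmulVec : ContDiffAt ℝ k
        (fun x : G × (ℝ × (Fin n → ℝ)) => (A x.1).mulVec x.2.2 i) u :=
      ContDiffAt.sum (s := Finset.univ) fun j _ => (hentry i j).mul (hvec j)
    exact hmulVec.sub (ContDiffAt.mul (by fun_prop) (hvec i))

theorem hasFDerivAt_eigenpairMap {n : ℕ} (v₀ : Fin n → ℝ) (M : Matrix (Fin n) (Fin n) ℝ)
    (p : ℝ × (Fin n → ℝ)) :
    ∃ D : (ℝ × (Fin n → ℝ)) →L[ℝ] (ℝ × (Fin n → ℝ)), HasFDerivAt (eigenpairMap v₀ M) D p ∧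
      ∀ q, D q = (v₀ ⬝ᵥ q.2, M.mulVec q.2 - (p.1 • q.2 + q.1 • p.2)) := by
  have hdot := (LinearMap.toContinuousLinearMap (dotProductBilin ℝ ℝ v₀)).hasFDerivAt.comp p
    (hasFDerivAt_snd (𝕜 := ℝ) (p := p))
  have hmul := (LinearMap.toContinuousLinearMap M.mulVecLin).hasFDerivAt.comp p
    (hasFDerivAt_snd (𝕜 := ℝ) (p := p))
  have hsmul := (hasFDerivAt_fst (𝕜 := ℝ) (p := p)).smul (hasFDerivAt_snd (𝕜 := ℝ) (p := p))
  exact ⟨_, hdot.prodMk (hmul.sub hsmul), fun q => rfl⟩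

/-- The linearized eigenpair equation at a unit eigenvector of a symmetric matrix has no nonzero
solution orthogonal to the eigenvector when the eigenvalue is simple. -/
theorem Matrix.IsSymm.eq_zero_of_linearized_eigenpair {n : ℕ} {M : Matrix (Fin n) (Fin n) ℝ}
    (hM : M.IsSymm) {lam₀ : ℝ} {v₀ : Fin n → ℝ} (hv₀ : v₀ ⬝ᵥ v₀ = 1)
    (heig : M.mulVec v₀ = lam₀ • v₀)
    (hsimple : Module.finrank ℝ
      (LinearMap.ker ((M - lam₀ • (1 : Matrix (Fin n) (Fin n) ℝ)).mulVecLin)) = 1)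
    {s : ℝ} {w : Fin n → ℝ} (horth : v₀ ⬝ᵥ w = 0)
    (hlin : M.mulVec w - (lam₀ • w + s • v₀) = 0) : s = 0 ∧ w = 0 := by
  have hadj : v₀ ⬝ᵥ M.mulVec w = 0 := by
    rw [Matrix.dotProduct_mulVec, ← Matrix.mulVec_transpose, hM.eq, heig, smul_dotProduct, horth,
      smul_zero]
  have hs : s = 0 := by
    have h := congrArg (v₀ ⬝ᵥ ·) hlin
    simpa [dotProduct_sub, dotProduct_add, dotProduct_smul, hadj, horth, hv₀] using h
  have hker {x : Fin n → ℝ} (hx : M.mulVec x = lam₀ • x) :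
      x ∈ LinearMap.ker ((M - lam₀ • (1 : Matrix (Fin n) (Fin n) ℝ)).mulVecLin) := by
    simp [hx]
  have hv0 : v₀ ≠ 0 := by
    rintro rfl
    simp at hv₀
  have hw : M.mulVec w = lam₀ • w := by simpa [hs, sub_eq_zero] using hlin
  obtain ⟨c, hc⟩ := (finrank_eq_one_iff_of_nonzero' ⟨v₀, hker heig⟩
    (by simpa [Subtype.ext_iff] using hv0)).1 hsimple ⟨w, hker hw⟩
  have hcw : c • v₀ = w := congrArg Subtype.val hc
  have hc0 : c = 0 := by simpa [← hcw, dotProduct_smul, hv₀] using horth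
  exact ⟨hs, by rw [← hcw, hc0, zero_smul]⟩

theorem isInvertible_of_injective_of_finiteDimensional {E : Type*} [NormedAddCommGroup E]
    [NormedSpace ℝ E] [FiniteDimensional ℝ E] {D : E →L[ℝ] E} (hD : Function.Injective D) :
    D.IsInvertible :=
  ⟨(LinearEquiv.ofInjectiveEndo (D : E →ₗ[ℝ] E) hD).toContinuousLinearEquiv, by ext; rfl⟩

/-- A simple eigenvalue of a `C^k` family of symmetric matrices admits local `C^k`
eigenvalue and eigenvector branches. -/
theorem stmt10 (n k : ℕ) (hn : 1 ≤ n) (hk : 1 ≤ k)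
    {G : Type*} [NormedAddCommGroup G] [NormedSpace ℝ G] [CompleteSpace G]
    (U : Set G) (hU : IsOpen U)
    (A : G → Matrix (Fin n) (Fin n) ℝ) (hAreg : ContDiffOn ℝ k A U)
    (hAsymm : ∀ γ ∈ U, (A γ).IsSymm)
    (γ₀ : G) (hγ₀ : γ₀ ∈ U) (lam₀ : ℝ) (v₀ : Fin n → ℝ)
    (hv₀ : Real.sqrt (∑ i, v₀ i ^ 2) = 1)
    (heig : (A γ₀).mulVec v₀ = lam₀ • v₀)
    (hsimple :
      Module.finrank ℝ
        (LinearMap.ker ((A γ₀ - lam₀ • (1 : Matrix (Fin n) (Fin n) ℝ)).mulVecLin)) = 1) :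
    ∃ V : Set G, IsOpen V ∧ γ₀ ∈ V ∧ V ⊆ U ∧
      ∃ (lam : G → ℝ) (v : G → Fin n → ℝ),
        ContDiffOn ℝ k lam V ∧ ContDiffOn ℝ k v V ∧
        lam γ₀ = lam₀ ∧ v γ₀ = v₀ ∧
        ∀ γ ∈ V, (A γ).mulVec (v γ) = lam γ • v γ := by
  have hunit : v₀ ⬝ᵥ v₀ = 1 := by
    simpa [dotProduct, sq] using Real.sqrt_eq_one.1 hv₀
  have hk0 : (k : WithTop ℕ∞) ≠ 0 := by exact_mod_cast (by omega : k ≠ 0)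
  set f : G × (ℝ × (Fin n → ℝ)) → ℝ × (Fin n → ℝ) :=
    fun x => eigenpairMap v₀ (A x.1) x.2 with hf
  set u : G × (ℝ × (Fin n → ℝ)) := (γ₀, (lam₀, v₀)) with hu
  have cdf : ContDiffAt ℝ k f u :=
    contDiffAt_eigenpairMap v₀ (hAreg.contDiffAt (hU.mem_nhds hγ₀))
  have hinv : (fderiv ℝ f u ∘L .inr ℝ G (ℝ × (Fin n → ℝ))).IsInvertible := by
    obtain ⟨D, hD, hDapply⟩ := hasFDerivAt_eigenpairMap v₀ (A γ₀) (lam₀, v₀)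
    have hpartial : HasFDerivAt (eigenpairMap v₀ (A γ₀))
        (fderiv ℝ f u ∘L .inr ℝ G (ℝ × (Fin n → ℝ))) (lam₀, v₀) :=
      (cdf.differentiableAt hk0).hasFDerivAt.comp (lam₀, v₀) (hasFDerivAt_prodMk_right γ₀ _)
    rw [hpartial.unique hD]
    refine isInvertible_of_injective_of_finiteDimensional
      ((injective_iff_map_eq_zero D).2 fun q hq => ?_)
    rw [hDapply, Prod.mk_eq_zero] at hq
    exact Prod.mk_eq_zero.2 ((hAsymm γ₀ hγ₀).eq_zero_of_linearized_eigenpair hunit heig hsimple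
      hq.1 hq.2)
  have hψ₀ : cdf.implicitFunction hk0 hinv γ₀ = (lam₀, v₀) :=
    cdf.implicitFunction_apply_self hk0 hinv
  have hψsol : ∀ᶠ γ in 𝓝 γ₀, f (γ, cdf.implicitFunction hk0 hinv γ) = f u :=
    cdf.eventually_apply_implicitFunction hk0 hinv
  have hψreg : ∀ᶠ γ in 𝓝 γ₀, ContDiffAt ℝ k (cdf.implicitFunction hk0 hinv) γ :=
    (cdf.contDiffAt_implicitFunction hk0 hinv).eventually (by simp)
  set ψ := cdf.implicitFunction hk0 hinv
  obtain ⟨V, hV, hVopen, hVmem⟩ :=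
    eventually_nhds_iff.1 ((hU.eventually_mem hγ₀).and (hψsol.and hψreg))
  refine ⟨V, hVopen, hVmem, fun γ hγ => (hV γ hγ).1, fun γ => (ψ γ).1, fun γ => (ψ γ).2,
    fun γ hγ => (hV γ hγ).2.2.fst.contDiffWithinAt,
    fun γ hγ => (hV γ hγ).2.2.snd.contDiffWithinAt,
    congrArg Prod.fst hψ₀, congrArg Prod.snd hψ₀, fun γ hγ => ?_⟩
  have h := congrArg Prod.snd (hV γ hγ).2.1
  simpa [hf, hu, eigenpairMap, heig, sub_eq_zero] using h
end
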